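/- Suppose the seller's background risk satisfies S ≤ 0 ℙ-almost surely. Then for every admissible indemnity I ∈ 𝓐, the buyer's expected utility satisfies 𝔼[u(W(I))] ≤ 𝔼[u(w − X)]; that is, the zero contract I ≡ 0 (no insurance) maximizes 𝔼[u(W(·))] over 𝓐. -/

import Mathlib

open MeasureTheory Set

noncomputable section

variable {Ω : Type*} [MeasurableSpace Ω]

/-- Expected-value premium of an indemnity `I = I(x, s)`. -/
def premium (ℙ : Measure Ω) (η : ℝ) (X S : Ω → ℝ) (I : ℝ → ℝ → ℝ) : ℝ :=
  (1 + η) * ∫ ω, I (X ω) (S ω) ∂ℙ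

/-- Buyer's terminal wealth under endogenous default with recovery ratio `τ`:
`W(I) = w − X − π(I) + 𝕀(I)` where `𝕀(I) = I·1_{I ≤ R} + τ·R·1_{I > R}` and
`R = (S + π(I))⁺`. -/
def wealth (ℙ : Measure Ω) (η τ w : ℝ) (X S : Ω → ℝ) (I : ℝ → ℝ → ℝ) (ω : Ω) : ℝ :=
  w - X ω - premium ℙ η X S I +
    (if I (X ω) (S ω) ≤ max (S ω + premium ℙ η X S I) 0 then I (X ω) (S ω)
     else τ * max (S ω + premium ℙ η X S I) 0)

/-- Buyer's expected utility `𝔼[u(W(I))]`. -/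
def EU (ℙ : Measure Ω) (η τ w : ℝ) (X S : Ω → ℝ) (u : ℝ → ℝ) (I : ℝ → ℝ → ℝ) : ℝ :=
  ∫ ω, u (wealth ℙ η τ w X S I ω) ∂ℙ

/-- Admissible indemnities `𝓐`: measurable and `0 ≤ I(x,s) ≤ x` on `[0, M] × ℝ`. -/
def Adm (M : ℝ) (I : ℝ → ℝ → ℝ) : Prop :=
  Measurable (fun p : ℝ × ℝ => I p.1 p.2) ∧
    ∀ x ∈ Icc (0 : ℝ) M, ∀ s : ℝ, 0 ≤ I x s ∧ I x s ≤ x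

/-- Full-insurance premium `π_f = (1+η)𝔼[X]`. -/
def piFull (ℙ : Measure Ω) (η : ℝ) (X : Ω → ℝ) : ℝ := (1 + η) * ∫ ω, X ω ∂ℙ

/-- `g(a) = (1+η)·𝔼[X − (X − (S+a)⁺)⁺] − a`. -/
def gfun (ℙ : Measure Ω) (η : ℝ) (X S : Ω → ℝ) (a : ℝ) : ℝ :=
  (1 + η) * ∫ ω, (X ω - max (X ω - max (S ω + a) 0) 0) ∂ℙ - a

/-- `ā = inf {a ∈ [0, π_f] : g(a) ≤ 0}`. -/
def abar (ℙ : Measure Ω) (η : ℝ) (X S : Ω → ℝ) : ℝ :=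
  sInf {a | a ∈ Icc 0 (piFull ℙ η X) ∧ gfun ℙ η X S a ≤ 0}

/-- A real function with positive essential supremum is almost surely bounded by it: otherwise
the essential supremum would take the value `sInf ∅ = 0`. -/
lemma ae_le_essSup_of_essSup_pos {ℙ : Measure Ω} {X : Ω → ℝ} (h : 0 < essSup X ℙ) :
    ∀ᵐ ω ∂ℙ, X ω ≤ essSup X ℙ := by
  refine ae_le_essSup ?_
  by_contra hb
  have hempty : {a : ℝ | ∀ᵐ ω ∂ℙ, X ω ≤ a} = ∅ :=
    eq_empty_of_forall_notMem fun a ha => hb ⟨a, by simpa using ha⟩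
  rw [essSup, Filter.limsup_eq, hempty, Real.sInf_empty] at h
  exact lt_irrefl _ h

/-- A monotone function of an almost surely bounded random variable is integrable. -/
lemma Monotone.integrable_comp_of_ae_mem_Icc {ℙ : Measure Ω} [IsFiniteMeasure ℙ]
    {u : ℝ → ℝ} (hu : Monotone u) {Y : Ω → ℝ} (hY : Measurable Y) {a b : ℝ}
    (h : ∀ᵐ ω ∂ℙ, Y ω ∈ Icc a b) : Integrable (fun ω => u (Y ω)) ℙ :=
  .of_mem_Icc (u a) (u b) (hu.measurable.comp hY).aemeasurable <| by
    filter_upwards [h] with ω hω using ⟨hu hω.1, hu hω.2⟩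

/-- If the seller's background risk satisfies `S ≤ 0` a.s., then for every
admissible indemnity `I ∈ 𝓐`, `𝔼[u(W(I))] ≤ 𝔼[u(w − X)]`; i.e. no insurance is optimal. -/
theorem stmt0
    (ℙ : Measure Ω) [IsProbabilityMeasure ℙ]
    (X S : Ω → ℝ) (hXm : Measurable X) (hSm : Measurable S)
    (hX0 : ∀ ω, 0 ≤ X ω) (M : ℝ) (hM : essSup X ℙ = M) (hM0 : 0 < M)
    (η : ℝ) (hη : 0 ≤ η) (τ : ℝ) (hτ : τ ∈ Icc (0 : ℝ) 1) (w : ℝ)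
    (u u' u'' : ℝ → ℝ)
    (hu' : ∀ x, HasDerivAt u (u' x) x) (hu'' : ∀ x, HasDerivAt u' (u'' x) x)
    (hu'pos : ∀ x, 0 < u' x) (hu''neg : ∀ x, u'' x < 0)
    (hSneg : ∀ᵐ ω ∂ℙ, S ω ≤ 0) :
    ∀ I : ℝ → ℝ → ℝ, Adm M I →
      EU ℙ η τ w X S u I ≤ ∫ ω, u (w - X ω) ∂ℙ := by
  intro I hI
  have hXM : ∀ᵐ ω ∂ℙ, X ω ≤ M := hM ▸ ae_le_essSup_of_essSup_pos (hM.symm ▸ hM0)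
  have hI0 : ∀ᵐ ω ∂ℙ, 0 ≤ I (X ω) (S ω) := by
    filter_upwards [hXM] with ω hω using (hI.2 _ ⟨hX0 ω, hω⟩ _).1
  have hIm : Measurable fun ω => I (X ω) (S ω) := hI.1.comp (hXm.prodMk hSm)
  have hp : 0 ≤ premium ℙ η X S I :=
    mul_nonneg (by linarith) (integral_nonneg_of_ae hI0)
  have hWm : Measurable (wealth ℙ η τ w X S I) := by
    unfold wealth
    have hR : Measurable fun ω => max (S ω + premium ℙ η X S I) 0 := by fun_prop
    exact ((hXm.const_sub w).sub_const _).add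
      (Measurable.ite (measurableSet_le hIm hR) hIm (hR.const_mul τ))
  have hle : ∀ᵐ ω ∂ℙ, wealth ℙ η τ w X S I ω ≤ w - X ω := by
    filter_upwards [hSneg] with ω hS
    have hR : max (S ω + premium ℙ η X S I) 0 ≤ premium ℙ η X S I :=
      max_le (by linarith) hp
    have hR0 : 0 ≤ max (S ω + premium ℙ η X S I) 0 := le_max_right _ _
    unfold wealth
    split_ifs with h
    · linarith
    · linarith [mul_le_of_le_one_left hR0 hτ.2]
  have hge : ∀ᵐ ω ∂ℙ, w - M - premium ℙ η X S I ≤ wealth ℙ η τ w X S I ω := by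
    filter_upwards [hXM, hI0] with ω hX hI
    unfold wealth
    split_ifs with h
    · linarith
    · linarith [mul_nonneg hτ.1 (le_max_right (S ω + premium ℙ η X S I) 0)]
  have hu : Monotone u := (strictMono_of_hasDerivAt_pos hu' hu'pos).monotone
  refine integral_mono_ae
    (hu.integrable_comp_of_ae_mem_Icc hWm (a := w - M - premium ℙ η X S I) (b := w) ?_)
    (hu.integrable_comp_of_ae_mem_Icc (hXm.const_sub w) (a := w - M) (b := w) ?_) ?_
  · filter_upwards [hge, hle] with ω h₁ h₂ using ⟨h₁, by linarith [hX0 ω]⟩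
  · filter_upwards [hXM] with ω h using ⟨by linarith, by linarith [hX0 ω]⟩
  · filter_upwards [hle] with ω h using hu h
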